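/- Let T be an n × n complex matrix with polar decomposition T = V|T|, and suppose that the spectrum of V contains no two opposite values, i.e. for any two eigenvalues λ ≠ μ of V one has λ + μ ≠ 0. Then the mean transform M(T) is a unitary matrix if and only if T is a unitary matrix (in which case T = V). -/

import Mathlib

open scoped ComplexOrder Matrix

/-- `T = V * R` is the polar decomposition of the matrix `T`: `R = |T|` is the positive
semidefinite square root of `Tᴴ T`, and `V` is a partial isometry with `ker V = ker T`. -/
def Matrix.IsPolarDecomposition {n : ℕ} (T V R : Matrix (Fin n) (Fin n) ℂ) : Prop :=
  R.PosSemidef ∧ R * R = Tᴴ * T ∧ T = V * R ∧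
    V * Vᴴ * V = V ∧ (∀ x : Fin n → ℂ, V.mulVec x = 0 ↔ T.mulVec x = 0)

open Polynomial in
/-- If `S` intertwines `-A` with `A`, it intertwines `p(-A)` with `p(A)` for every polynomial `p`. -/
theorem Matrix.aeval_mul_eq_mul_aeval_neg {n : ℕ} {A S : Matrix (Fin n) (Fin n) ℂ}
    (h : A * S = S * -A) (p : ℂ[X]) : aeval A p * S = S * aeval (-A) p := by
  induction p using Polynomial.induction_on' with
  | add p q hp hq => simp only [map_add, add_mul, mul_add, hp, hq]
  | monomial k a =>
    have hk : A ^ k * S = S * (-A) ^ k :=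
      (SemiconjBy.pow_right (show SemiconjBy S (-A) A from h.symm) k).symm
    simp only [aeval_monomial, Algebra.algebraMap_eq_smul_one, smul_mul_assoc, one_mul,
      mul_smul_comm, hk]

/-- A matrix anticommuting with `A` vanishes if `A` and `-A` have disjoint spectra. -/
theorem Matrix.eq_zero_of_anticommute {n : ℕ} {A S : Matrix (Fin n) (Fin n) ℂ}
    (h : A * S = S * -A) (hA : ∀ z ∈ spectrum ℂ A, -z ∉ spectrum ℂ A) : S = 0 := by
  rcases isEmpty_or_nonempty (Fin n) with _ | _
  · exact Subsingleton.elim _ _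
  have hS := Matrix.aeval_mul_eq_mul_aeval_neg h A.charpoly
  rw [Matrix.aeval_self_charpoly, zero_mul] at hS
  have hu : IsUnit (Polynomial.aeval (-A) A.charpoly) := by
    rw [← spectrum.zero_notMem_iff ℂ,
      spectrum.map_polynomial_aeval_of_nonempty _ _
        (spectrum.nonempty_of_isAlgClosed_of_finiteDimensional ℂ _)]
    rintro ⟨z, hz, hz0⟩
    rw [← spectrum.neg_eq, Set.mem_neg] at hz
    refine hA _ hz ?_
    rw [neg_neg]
    exact Matrix.mem_spectrum_iff_isRoot_charpoly.2 hz0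
  exact (hu.mul_left_eq_zero).1 hS.symm

/-- The identity is the only positive semidefinite involution. -/
theorem Matrix.PosSemidef.eq_one_of_mul_self {n : ℕ} {A : Matrix (Fin n) (Fin n) ℂ}
    (hA : A.PosSemidef) (h : A * A = 1) : A = 1 := by
  have hu : IsUnit (A + 1) := (Matrix.PosDef.posSemidef_add hA Matrix.PosDef.one).isUnit
  have h0 : (A - 1) * (A + 1) = 0 := by
    rw [sub_mul, mul_add, h, mul_one, one_mul, add_comm, sub_self]
  exact sub_eq_zero.1 ((hu.mul_left_eq_zero).1 h0)

/-- if no two distinct eigenvalues of `V` are opposite, then `M(T)` is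
unitary iff `T` is unitary, in which case `T = V`. -/
theorem meanTransform_unitary_iff {n : ℕ} (T V R : Matrix (Fin n) (Fin n) ℂ)
    (hpd : Matrix.IsPolarDecomposition T V R)
    (hspec : ∀ lam mu : ℂ, lam ∈ spectrum ℂ V → mu ∈ spectrum ℂ V →
      lam ≠ mu → lam + mu ≠ 0) :
    ((2 : ℂ)⁻¹ • (T + R * V) ∈ Matrix.unitaryGroup (Fin n) ℂ ↔
      T ∈ Matrix.unitaryGroup (Fin n) ℂ) ∧
    ((2 : ℂ)⁻¹ • (T + R * V) ∈ Matrix.unitaryGroup (Fin n) ℂ → T = V) := by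
  obtain ⟨hR, hRR, hT, hV, hker⟩ := hpd
  have key : (2 : ℂ)⁻¹ • (T + R * V) ∈ Matrix.unitaryGroup (Fin n) ℂ →
      R = 1 ∧ Vᴴ * V = 1 := by
    intro hM
    have hVu : IsUnit V := by
      rw [← Matrix.mulVec_injective_iff_isUnit, ← Matrix.coe_mulVecLin,
        ← LinearMap.ker_eq_bot, LinearMap.ker_eq_bot']
      intro x hx
      rw [Matrix.mulVecLin_apply] at hx
      have hMx : ((2 : ℂ)⁻¹ • (T + R * V)).mulVec x = 0 := by
        rw [Matrix.smul_mulVec, Matrix.add_mulVec, (hker x).1 hx, ← Matrix.mulVec_mulVec, hx]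
        simp
      rw [← Matrix.one_mulVec x, ← Matrix.mem_unitaryGroup_iff'.1 hM, ← Matrix.mulVec_mulVec,
        hMx, Matrix.mulVec_zero]
    have hVV : Vᴴ * V = 1 := hVu.mul_left_cancel (by rw [← mul_assoc, hV, mul_one])
    have hVV' : V * Vᴴ = 1 := mul_eq_one_comm.1 hVV
    have hP : Vᴴ * ((2 : ℂ)⁻¹ • (T + R * V)) = (2 : ℂ)⁻¹ • (R + Vᴴ * R * V) := by
      rw [hT, mul_smul_comm, mul_add, ← mul_assoc, hVV, one_mul, mul_assoc]
    have hPpos : ((2 : ℂ)⁻¹ • (R + Vᴴ * R * V)).PosSemidef :=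
      (hR.add (hR.conjTranspose_mul_mul_same V)).smul (by positivity)
    have hPP : ((2 : ℂ)⁻¹ • (R + Vᴴ * R * V)) * ((2 : ℂ)⁻¹ • (R + Vᴴ * R * V)) = 1 := by
      have hVmem : Vᴴ ∈ Matrix.unitaryGroup (Fin n) ℂ :=
        Matrix.mem_unitaryGroup_iff.2 (by
          rw [Matrix.star_eq_conjTranspose, Matrix.conjTranspose_conjTranspose, hVV])
      have hmem := Matrix.mem_unitaryGroup_iff'.1 (mul_mem hVmem hM)
      rwa [hP, Matrix.star_eq_conjTranspose, hPpos.isHermitian.eq] at hmem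
    have hsum : R + Vᴴ * R * V = (2 : ℂ) • 1 := by
      rw [← hPpos.eq_one_of_mul_self hPP, smul_smul]; norm_num
    have hanti : V * R + R * V = (2 : ℂ) • V := by
      have := congrArg (V * ·) hsum
      simpa [mul_add, ← mul_assoc, hVV'] using this
    refine ⟨sub_eq_zero.1 (Matrix.eq_zero_of_anticommute (A := V) ?_ ?_), hVV⟩
    · rw [two_smul] at hanti
      rw [mul_sub, mul_neg, sub_mul, mul_one, one_mul, neg_sub, sub_eq_sub_iff_add_eq_add, hanti]
    · intro z hz hz'
      refine hspec z (-z) hz hz' (fun hzz => ?_) (add_neg_cancel z)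
      rw [self_eq_neg.1 hzz] at hz
      exact spectrum.zero_notMem ℂ hVu hz
  refine ⟨⟨fun hM => ?_, fun hTu => ?_⟩, fun hM => by rw [hT, (key hM).1, mul_one]⟩
  · obtain ⟨h1, h2⟩ := key hM
    rw [hT, h1, mul_one]
    exact Matrix.mem_unitaryGroup_iff'.2 h2
  · have h1 : R = 1 := hR.eq_one_of_mul_self (hRR.trans (Matrix.mem_unitaryGroup_iff'.1 hTu))
    rw [h1, mul_one] at hT
    rwa [h1, one_mul, ← hT, ← two_smul ℂ T, smul_smul, inv_mul_cancel₀ two_ne_zero, one_smul]
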